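/- arXiv:2006.15867 — 3 statements merged into one kernel-verified Lean document; each statement's English description precedes it below -/
import Mathlib

section
/- Let T be an invertible block TBT-matrix and let λ = (λ₁,λ₂) with λ₁,λ₂ ∉ {i/2, −i/2}. Then for p = 1,2: (A_p^* − λ_pI)^{−1} Γ_p û_p(λ) = i R (A₁ − λ₁I)^{−1}(A₂ − λ₂I)^{−1} ℒ. -/
open Matrix Kronecker BigOperators

noncomputable section

namespace TBT

/-- The entries `a_r` of the matrices `𝒜_p`. -/
def aEnt (r : ℤ) : ℂ := if r < 0 then 0 else if r = 0 then Complex.I / 2 else Complex.I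

/-- The `n × n` matrix `𝒜 = {a_{j-ℓ}}`. -/
def calA (n : ℕ) : Matrix (Fin n) (Fin n) ℂ :=
  Matrix.of fun j ℓ => aEnt (((j : ℕ) : ℤ) - ((ℓ : ℕ) : ℤ))

/-- The index type of the `m × m` matrices, `m = m₁ m₂ m₃`. -/
abbrev Idx (m₁ m₂ m₃ : ℕ) := (Fin m₁ × Fin m₂) × Fin m₃

/-- `A₁ = 𝒜₁ ⊗ I_{m₂} ⊗ I_{m₃}`. -/
def A1 (m₁ m₂ m₃ : ℕ) : Matrix (Idx m₁ m₂ m₃) (Idx m₁ m₂ m₃) ℂ :=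
  (calA m₁ ⊗ₖ (1 : Matrix (Fin m₂) (Fin m₂) ℂ)) ⊗ₖ (1 : Matrix (Fin m₃) (Fin m₃) ℂ)

/-- `A₂ = I_{m₁} ⊗ 𝒜₂ ⊗ I_{m₃}`. -/
def A2 (m₁ m₂ m₃ : ℕ) : Matrix (Idx m₁ m₂ m₃) (Idx m₁ m₂ m₃) ℂ :=
  ((1 : Matrix (Fin m₁) (Fin m₁) ℂ) ⊗ₖ calA m₂) ⊗ₖ (1 : Matrix (Fin m₃) (Fin m₃) ℂ)

/-- `A₃ = I_{m₁} ⊗ I_{m₂} ⊗ 𝒜₃`. -/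
def A3 (m₁ m₂ m₃ : ℕ) : Matrix (Idx m₁ m₂ m₃) (Idx m₁ m₂ m₃) ℂ :=
  ((1 : Matrix (Fin m₁) (Fin m₁) ℂ) ⊗ₖ (1 : Matrix (Fin m₂) (Fin m₂) ℂ)) ⊗ₖ calA m₃

/-- The block TBT-matrix `T = {𝒯_{i-k}}`, `𝒯_r = {t^{(r)}_{i-k}}`, built from the
data `t : ℤ → ℤ → Matrix (Fin m₃) (Fin m₃) ℂ` of its `m₃ × m₃` blocks. -/
def Tmat (m₁ m₂ m₃ : ℕ) (t : ℤ → ℤ → Matrix (Fin m₃) (Fin m₃) ℂ) :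
    Matrix (Idx m₁ m₂ m₃) (Idx m₁ m₂ m₃) ℂ :=
  Matrix.of fun x y =>
    t (((x.1.1 : ℕ) : ℤ) - ((y.1.1 : ℕ) : ℤ)) (((x.1.2 : ℕ) : ℤ) - ((y.1.2 : ℕ) : ℤ)) x.2 y.2

/-- The Toeplitz blocks `𝒯_r = {t^{(r)}_{i-k}}` of a block TBT-matrix. -/
def calT (m₂ m₃ : ℕ) (t : ℤ → ℤ → Matrix (Fin m₃) (Fin m₃) ℂ) (r : ℤ) :
    Matrix (Fin m₂ × Fin m₃) (Fin m₂ × Fin m₃) ℂ :=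
  Matrix.of fun x y => t r (((x.1 : ℕ) : ℤ) - ((y.1 : ℕ) : ℤ)) x.2 y.2

/-- `M₁₁ = col [M₁₁⁽¹⁾ … M₁₁⁽ᵐ¹⁾]`, `M₁₁⁽ⁱ⁾ = (1/2)𝒯₀ + Σ_{s=1}^{i-1} 𝒯_s`. -/
def M11 (m₁ m₂ m₃ : ℕ) (t : ℤ → ℤ → Matrix (Fin m₃) (Fin m₃) ℂ) :
    Matrix (Idx m₁ m₂ m₃) (Fin m₂ × Fin m₃) ℂ :=
  Matrix.of fun x y =>
    ((2 : ℂ)⁻¹ • calT m₂ m₃ t 0 +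
      ∑ s ∈ Finset.range (x.1.1 : ℕ), calT m₂ m₃ t ((s : ℤ) + 1)) (x.1.2, x.2) y

/-- `M₂₁ = 1_{m₁}^* ⊗ I_{m₂ m₃}`. -/
def M21 (m₁ m₂ m₃ : ℕ) : Matrix (Fin m₂ × Fin m₃) (Idx m₁ m₂ m₃) ℂ :=
  Matrix.of fun y x => if y.1 = x.1.2 ∧ y.2 = x.2 then 1 else 0

/-- `M₃₁ = M₂₁^*`. -/
def M31 (m₁ m₂ m₃ : ℕ) : Matrix (Idx m₁ m₂ m₃) (Fin m₂ × Fin m₃) ℂ := (M21 m₁ m₂ m₃)ᴴ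

/-- `M₄₁ = [M₄₁⁽¹⁾ … M₄₁⁽ᵐ¹⁾]`, `M₄₁⁽ᵏ⁾ = (1/2)𝒯₀ + Σ_{s=1}^{k-1} 𝒯_{-s}`. -/
def M41 (m₁ m₂ m₃ : ℕ) (t : ℤ → ℤ → Matrix (Fin m₃) (Fin m₃) ℂ) :
    Matrix (Fin m₂ × Fin m₃) (Idx m₁ m₂ m₃) ℂ :=
  Matrix.of fun y x =>
    ((2 : ℂ)⁻¹ • calT m₂ m₃ t 0 +
      ∑ s ∈ Finset.range (x.1.1 : ℕ), calT m₂ m₃ t (-((s : ℤ) + 1))) y (x.1.2, x.2)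

/-- The blocks `M₁₂⁽ʳ⁾ = col [(1/2)t₀⁽ʳ⁾, (1/2)t₀⁽ʳ⁾ + t₁⁽ʳ⁾, …]`. -/
def M12blk (m₂ m₃ : ℕ) (t : ℤ → ℤ → Matrix (Fin m₃) (Fin m₃) ℂ) (r : ℤ) :
    Matrix (Fin m₂ × Fin m₃) (Fin m₃) ℂ :=
  Matrix.of fun x l =>
    ((2 : ℂ)⁻¹ • t r 0 + ∑ j ∈ Finset.range (x.1 : ℕ), t r ((j : ℤ) + 1)) x.2 l

/-- `M₁₂ = {M₁₂^{(i-k)}}_{i,k=1}^{m₁}`. -/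
def M12 (m₁ m₂ m₃ : ℕ) (t : ℤ → ℤ → Matrix (Fin m₃) (Fin m₃) ℂ) :
    Matrix (Idx m₁ m₂ m₃) (Fin m₁ × Fin m₃) ℂ :=
  Matrix.of fun x y => M12blk m₂ m₃ t (((x.1.1 : ℕ) : ℤ) - ((y.1 : ℕ) : ℤ)) (x.1.2, x.2) y.2

/-- `M₂₂ = I_{m₁} ⊗ 1_{m₂}^* ⊗ I_{m₃}`. -/
def M22 (m₁ m₂ m₃ : ℕ) : Matrix (Fin m₁ × Fin m₃) (Idx m₁ m₂ m₃) ℂ :=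
  Matrix.of fun y x => if y.1 = x.1.1 ∧ y.2 = x.2 then 1 else 0

/-- `M₃₂ = M₂₂^*`. -/
def M32 (m₁ m₂ m₃ : ℕ) : Matrix (Idx m₁ m₂ m₃) (Fin m₁ × Fin m₃) ℂ := (M22 m₁ m₂ m₃)ᴴ

/-- The blocks `M₄₂⁽ʳ⁾ = [(1/2)t₀⁽ʳ⁾, (1/2)t₀⁽ʳ⁾ + t₋₁⁽ʳ⁾, …]`. -/
def M42blk (m₂ m₃ : ℕ) (t : ℤ → ℤ → Matrix (Fin m₃) (Fin m₃) ℂ) (r : ℤ) :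
    Matrix (Fin m₃) (Fin m₂ × Fin m₃) ℂ :=
  Matrix.of fun l x =>
    ((2 : ℂ)⁻¹ • t r 0 + ∑ j ∈ Finset.range (x.1 : ℕ), t r (-((j : ℤ) + 1))) l x.2

/-- `M₄₂ = {M₄₂^{(i-k)}}_{i,k=1}^{m₁}`. -/
def M42 (m₁ m₂ m₃ : ℕ) (t : ℤ → ℤ → Matrix (Fin m₃) (Fin m₃) ℂ) :
    Matrix (Fin m₁ × Fin m₃) (Idx m₁ m₂ m₃) ℂ :=
  Matrix.of fun y x => M42blk m₂ m₃ t (((y.1 : ℕ) : ℤ) - ((x.1.1 : ℕ) : ℤ)) y.2 (x.1.2, x.2)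

/-- `Π₁ = [M₁₁ M₃₁]`. -/
def Pi1 (m₁ m₂ m₃ : ℕ) (t : ℤ → ℤ → Matrix (Fin m₃) (Fin m₃) ℂ) :
    Matrix (Idx m₁ m₂ m₃) ((Fin m₂ × Fin m₃) ⊕ (Fin m₂ × Fin m₃)) ℂ :=
  Matrix.fromCols (M11 m₁ m₂ m₃ t) (M31 m₁ m₂ m₃)

/-- `Π₂ = [M₁₂ M₃₂]`. -/
def Pi2 (m₁ m₂ m₃ : ℕ) (t : ℤ → ℤ → Matrix (Fin m₃) (Fin m₃) ℂ) :
    Matrix (Idx m₁ m₂ m₃) ((Fin m₁ × Fin m₃) ⊕ (Fin m₁ × Fin m₃)) ℂ :=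
  Matrix.fromCols (M12 m₁ m₂ m₃ t) (M32 m₁ m₂ m₃)

/-- `Π̂₁ = col [M₂₁; M₄₁]`. -/
def Pihat1 (m₁ m₂ m₃ : ℕ) (t : ℤ → ℤ → Matrix (Fin m₃) (Fin m₃) ℂ) :
    Matrix ((Fin m₂ × Fin m₃) ⊕ (Fin m₂ × Fin m₃)) (Idx m₁ m₂ m₃) ℂ :=
  Matrix.fromRows (M21 m₁ m₂ m₃) (M41 m₁ m₂ m₃ t)

/-- `Π̂₂ = col [M₂₂; M₄₂]`. -/
def Pihat2 (m₁ m₂ m₃ : ℕ) (t : ℤ → ℤ → Matrix (Fin m₃) (Fin m₃) ℂ) :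
    Matrix ((Fin m₁ × Fin m₃) ⊕ (Fin m₁ × Fin m₃)) (Idx m₁ m₂ m₃) ℂ :=
  Matrix.fromRows (M22 m₁ m₂ m₃) (M42 m₁ m₂ m₃ t)

/-- `Γ₁ = T⁻¹ Π₁`. -/
def Gamma1 (m₁ m₂ m₃ : ℕ) (t : ℤ → ℤ → Matrix (Fin m₃) (Fin m₃) ℂ) :
    Matrix (Idx m₁ m₂ m₃) ((Fin m₂ × Fin m₃) ⊕ (Fin m₂ × Fin m₃)) ℂ :=
  (Tmat m₁ m₂ m₃ t)⁻¹ * Pi1 m₁ m₂ m₃ t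

/-- `Γ₂ = T⁻¹ Π₂`. -/
def Gamma2 (m₁ m₂ m₃ : ℕ) (t : ℤ → ℤ → Matrix (Fin m₃) (Fin m₃) ℂ) :
    Matrix (Idx m₁ m₂ m₃) ((Fin m₁ × Fin m₃) ⊕ (Fin m₁ × Fin m₃)) ℂ :=
  (Tmat m₁ m₂ m₃ t)⁻¹ * Pi2 m₁ m₂ m₃ t

/-- `Γ̂₁ = Π̂₁ T⁻¹`. -/
def Gammahat1 (m₁ m₂ m₃ : ℕ) (t : ℤ → ℤ → Matrix (Fin m₃) (Fin m₃) ℂ) :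
    Matrix ((Fin m₂ × Fin m₃) ⊕ (Fin m₂ × Fin m₃)) (Idx m₁ m₂ m₃) ℂ :=
  Pihat1 m₁ m₂ m₃ t * (Tmat m₁ m₂ m₃ t)⁻¹

/-- `Γ̂₂ = Π̂₂ T⁻¹`. -/
def Gammahat2 (m₁ m₂ m₃ : ℕ) (t : ℤ → ℤ → Matrix (Fin m₃) (Fin m₃) ℂ) :
    Matrix ((Fin m₁ × Fin m₃) ⊕ (Fin m₁ × Fin m₃)) (Idx m₁ m₂ m₃) ℂ :=
  Pihat2 m₁ m₂ m₃ t * (Tmat m₁ m₂ m₃ t)⁻¹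

/-- `ℒ = 1_{m₁m₂} ⊗ I_{m₃}`. -/
def Lmat (m₁ m₂ m₃ : ℕ) : Matrix (Idx m₁ m₂ m₃) (Fin m₃) ℂ :=
  Matrix.of fun x l => if x.2 = l then 1 else 0

/-- `ℒ_p = 1_{m_p} ⊗ I_{m₃}`. -/
def Lp (n m₃ : ℕ) : Matrix (Fin n × Fin m₃) (Fin m₃) ℂ :=
  Matrix.of fun x l => if x.2 = l then 1 else 0

/-- A row vector `v` Kronecker the identity `I_{m₃}`. -/
def rowKronId {n : Type*} (m₃ : ℕ) (v : n → ℂ) : Matrix (Fin m₃) (n × Fin m₃) ℂ :=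
  Matrix.of fun l x => v x.1 * (if l = x.2 then 1 else 0)

/-- A column vector `v` Kronecker the identity `I_{m₃}`. -/
def colKronId {n : Type*} (m₃ : ℕ) (v : n → ℂ) : Matrix (n × Fin m₃) (Fin m₃) ℂ :=
  Matrix.of fun x l => v x.1 * (if x.2 = l then 1 else 0)

/-- `ω(λ,μ) = ℒ^* (A₁^*-μ₁I)⁻¹ (A₂^*-μ₂I)⁻¹ T⁻¹ (A₁-λ₁I)⁻¹ (A₂-λ₂I)⁻¹ ℒ`. -/
def omegaF (m₁ m₂ m₃ : ℕ) (t : ℤ → ℤ → Matrix (Fin m₃) (Fin m₃) ℂ) (l₁ l₂ mu₁ mu₂ : ℂ) :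
    Matrix (Fin m₃) (Fin m₃) ℂ :=
  (Lmat m₁ m₂ m₃)ᴴ * ((A1 m₁ m₂ m₃)ᴴ - mu₁ • 1)⁻¹ * ((A2 m₁ m₂ m₃)ᴴ - mu₂ • 1)⁻¹ *
    (Tmat m₁ m₂ m₃ t)⁻¹ * (A1 m₁ m₂ m₃ - l₁ • 1)⁻¹ * (A2 m₁ m₂ m₃ - l₂ • 1)⁻¹ *
    Lmat m₁ m₂ m₃

/-- `v₁(μ) = ℒ^* (A₁^*-μ₁I)⁻¹ (A₂^*-μ₂I)⁻¹ Γ₁`. -/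
def v1 (m₁ m₂ m₃ : ℕ) (t : ℤ → ℤ → Matrix (Fin m₃) (Fin m₃) ℂ) (mu₁ mu₂ : ℂ) :
    Matrix (Fin m₃) ((Fin m₂ × Fin m₃) ⊕ (Fin m₂ × Fin m₃)) ℂ :=
  (Lmat m₁ m₂ m₃)ᴴ * ((A1 m₁ m₂ m₃)ᴴ - mu₁ • 1)⁻¹ * ((A2 m₁ m₂ m₃)ᴴ - mu₂ • 1)⁻¹ *
    Gamma1 m₁ m₂ m₃ t

/-- `v₂(μ) = ℒ^* (A₁^*-μ₁I)⁻¹ (A₂^*-μ₂I)⁻¹ Γ₂`. -/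
def v2 (m₁ m₂ m₃ : ℕ) (t : ℤ → ℤ → Matrix (Fin m₃) (Fin m₃) ℂ) (mu₁ mu₂ : ℂ) :
    Matrix (Fin m₃) ((Fin m₁ × Fin m₃) ⊕ (Fin m₁ × Fin m₃)) ℂ :=
  (Lmat m₁ m₂ m₃)ᴴ * ((A1 m₁ m₂ m₃)ᴴ - mu₁ • 1)⁻¹ * ((A2 m₁ m₂ m₃)ᴴ - mu₂ • 1)⁻¹ *
    Gamma2 m₁ m₂ m₃ t

/-- `v̂₁(λ) = Γ̂₁ (A₁-λ₁I)⁻¹ (A₂-λ₂I)⁻¹ ℒ`. -/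
def vhat1 (m₁ m₂ m₃ : ℕ) (t : ℤ → ℤ → Matrix (Fin m₃) (Fin m₃) ℂ) (l₁ l₂ : ℂ) :
    Matrix ((Fin m₂ × Fin m₃) ⊕ (Fin m₂ × Fin m₃)) (Fin m₃) ℂ :=
  Gammahat1 m₁ m₂ m₃ t * (A1 m₁ m₂ m₃ - l₁ • 1)⁻¹ * (A2 m₁ m₂ m₃ - l₂ • 1)⁻¹ * Lmat m₁ m₂ m₃

/-- `v̂₂(λ) = Γ̂₂ (A₁-λ₁I)⁻¹ (A₂-λ₂I)⁻¹ ℒ`. -/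
def vhat2 (m₁ m₂ m₃ : ℕ) (t : ℤ → ℤ → Matrix (Fin m₃) (Fin m₃) ℂ) (l₁ l₂ : ℂ) :
    Matrix ((Fin m₁ × Fin m₃) ⊕ (Fin m₁ × Fin m₃)) (Fin m₃) ℂ :=
  Gammahat2 m₁ m₂ m₃ t * (A1 m₁ m₂ m₃ - l₁ • 1)⁻¹ * (A2 m₁ m₂ m₃ - l₂ • 1)⁻¹ * Lmat m₁ m₂ m₃

/-- `u₁(μ) = v₁(μ) - i (1_{m₂}^* (𝒜₂^*-μ₂I)⁻¹ ⊗ I_{m₃}) [I_{m₂m₃} 0]`. -/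
def u1 (m₁ m₂ m₃ : ℕ) (t : ℤ → ℤ → Matrix (Fin m₃) (Fin m₃) ℂ) (mu₁ mu₂ : ℂ) :
    Matrix (Fin m₃) ((Fin m₂ × Fin m₃) ⊕ (Fin m₂ × Fin m₃)) ℂ :=
  v1 m₁ m₂ m₃ t mu₁ mu₂ -
    Complex.I • Matrix.fromCols
      (rowKronId m₃ (Matrix.vecMul (fun _ : Fin m₂ => (1 : ℂ)) (((calA m₂)ᴴ - mu₂ • 1)⁻¹))) 0

/-- `u₂(μ) = v₂(μ) - i (1_{m₁}^* (𝒜₁^*-μ₁I)⁻¹ ⊗ I_{m₃}) [I_{m₁m₃} 0]`. -/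
def u2 (m₁ m₂ m₃ : ℕ) (t : ℤ → ℤ → Matrix (Fin m₃) (Fin m₃) ℂ) (mu₁ mu₂ : ℂ) :
    Matrix (Fin m₃) ((Fin m₁ × Fin m₃) ⊕ (Fin m₁ × Fin m₃)) ℂ :=
  v2 m₁ m₂ m₃ t mu₁ mu₂ -
    Complex.I • Matrix.fromCols
      (rowKronId m₃ (Matrix.vecMul (fun _ : Fin m₁ => (1 : ℂ)) (((calA m₁)ᴴ - mu₁ • 1)⁻¹))) 0

/-- `û₁(λ) = v̂₁(λ) + i col[0; I_{m₂m₃}] ((𝒜₂-λ₂I)⁻¹ 1_{m₂} ⊗ I_{m₃})`. -/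
def uhat1 (m₁ m₂ m₃ : ℕ) (t : ℤ → ℤ → Matrix (Fin m₃) (Fin m₃) ℂ) (l₁ l₂ : ℂ) :
    Matrix ((Fin m₂ × Fin m₃) ⊕ (Fin m₂ × Fin m₃)) (Fin m₃) ℂ :=
  vhat1 m₁ m₂ m₃ t l₁ l₂ +
    Complex.I • Matrix.fromRows 0
      (colKronId m₃ (Matrix.mulVec ((calA m₂ - l₂ • 1)⁻¹) (fun _ : Fin m₂ => (1 : ℂ))))

/-- `û₂(λ) = v̂₂(λ) + i col[0; I_{m₁m₃}] ((𝒜₁-λ₁I)⁻¹ 1_{m₁} ⊗ I_{m₃})`. -/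
def uhat2 (m₁ m₂ m₃ : ℕ) (t : ℤ → ℤ → Matrix (Fin m₃) (Fin m₃) ℂ) (l₁ l₂ : ℂ) :
    Matrix ((Fin m₁ × Fin m₃) ⊕ (Fin m₁ × Fin m₃)) (Fin m₃) ℂ :=
  vhat2 m₁ m₂ m₃ t l₁ l₂ +
    Complex.I • Matrix.fromRows 0
      (colKronId m₃ (Matrix.mulVec ((calA m₁ - l₁ • 1)⁻¹) (fun _ : Fin m₁ => (1 : ℂ))))

/-- `K₁₁ = col [(1/2)M₄₂⁽⁰⁾, (1/2)M₄₂⁽⁰⁾+M₄₂⁽¹⁾, …]`. -/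
def K11 (m₁ m₂ m₃ : ℕ) (t : ℤ → ℤ → Matrix (Fin m₃) (Fin m₃) ℂ) :
    Matrix (Fin m₁ × Fin m₃) (Fin m₂ × Fin m₃) ℂ :=
  Matrix.of fun y x =>
    ((2 : ℂ)⁻¹ • M42blk m₂ m₃ t 0 +
      ∑ j ∈ Finset.range (y.1 : ℕ), M42blk m₂ m₃ t ((j : ℤ) + 1)) y.2 x

/-- `K₁₂ = [(1/2)M₁₂⁽⁰⁾, (1/2)M₁₂⁽⁰⁾+M₁₂⁽⁻¹⁾, …]`. -/
def K12 (m₁ m₂ m₃ : ℕ) (t : ℤ → ℤ → Matrix (Fin m₃) (Fin m₃) ℂ) :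
    Matrix (Fin m₂ × Fin m₃) (Fin m₁ × Fin m₃) ℂ :=
  Matrix.of fun y x =>
    ((2 : ℂ)⁻¹ • M12blk m₂ m₃ t 0 +
      ∑ j ∈ Finset.range (x.1 : ℕ), M12blk m₂ m₃ t (-((j : ℤ) + 1))) y x.2

/-- `K = [(1/2)M₄₂⁽⁰⁾, (1/2)M₄₂⁽⁰⁾+M₄₂⁽⁻¹⁾, …]`. -/
def Kmat (m₁ m₂ m₃ : ℕ) (t : ℤ → ℤ → Matrix (Fin m₃) (Fin m₃) ℂ) :
    Matrix (Fin m₃) (Idx m₁ m₂ m₃) ℂ :=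
  Matrix.of fun l x =>
    ((2 : ℂ)⁻¹ • M42blk m₂ m₃ t 0 +
      ∑ j ∈ Finset.range (x.1.1 : ℕ), M42blk m₂ m₃ t (-((j : ℤ) + 1))) l (x.1.2, x.2)

/-- `N = col [(1/2)M₁₂⁽⁰⁾, (1/2)M₁₂⁽⁰⁾+M₁₂⁽¹⁾, …]`. -/
def Nmat (m₁ m₂ m₃ : ℕ) (t : ℤ → ℤ → Matrix (Fin m₃) (Fin m₃) ℂ) :
    Matrix (Idx m₁ m₂ m₃) (Fin m₃) ℂ :=
  Matrix.of fun x l =>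
    ((2 : ℂ)⁻¹ • M12blk m₂ m₃ t 0 +
      ∑ j ∈ Finset.range (x.1.1 : ℕ), M12blk m₂ m₃ t ((j : ℤ) + 1)) (x.1.2, x.2) l

/-- `diag {(𝒜-zI) ⊗ I_{m₃}, (𝒜-zI) ⊗ I_{m₃}}` (the diagonal blocks `G₁₁`, `G₂₂`). -/
def diagKron (n m₃ : ℕ) (z : ℂ) :
    Matrix ((Fin n × Fin m₃) ⊕ (Fin n × Fin m₃)) ((Fin n × Fin m₃) ⊕ (Fin n × Fin m₃)) ℂ :=
  Matrix.fromBlocks ((calA n - z • 1) ⊗ₖ (1 : Matrix (Fin m₃) (Fin m₃) ℂ)) 0 0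
    ((calA n - z • 1) ⊗ₖ (1 : Matrix (Fin m₃) (Fin m₃) ℂ))

/-- `diag {(𝒜^*-zI) ⊗ I_{m₃}, (𝒜^*-zI) ⊗ I_{m₃}}` (the diagonal blocks `E₁₁`, `E₂₂`). -/
def diagKronH (n m₃ : ℕ) (z : ℂ) :
    Matrix ((Fin n × Fin m₃) ⊕ (Fin n × Fin m₃)) ((Fin n × Fin m₃) ⊕ (Fin n × Fin m₃)) ℂ :=
  Matrix.fromBlocks (((calA n)ᴴ - z • 1) ⊗ₖ (1 : Matrix (Fin m₃) (Fin m₃) ℂ)) 0 0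
    (((calA n)ᴴ - z • 1) ⊗ₖ (1 : Matrix (Fin m₃) (Fin m₃) ℂ))

/-- `𝔄(z) = diag {(𝒜^*-zI) ⊗ I_{m₃}, (𝒜-zI) ⊗ I_{m₃}}`. -/
def frakA (n m₃ : ℕ) (z : ℂ) :
    Matrix ((Fin n × Fin m₃) ⊕ (Fin n × Fin m₃)) ((Fin n × Fin m₃) ⊕ (Fin n × Fin m₃)) ℂ :=
  Matrix.fromBlocks (((calA n)ᴴ - z • 1) ⊗ₖ (1 : Matrix (Fin m₃) (Fin m₃) ℂ)) 0 0
    ((calA n - z • 1) ⊗ₖ (1 : Matrix (Fin m₃) (Fin m₃) ℂ))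

/-- `G₁₂ = i (Π̂₁ Γ₂ - [[ℒ₂ℒ₁^*, 0], [K₁₂, 0]])`. -/
def G12 (m₁ m₂ m₃ : ℕ) (t : ℤ → ℤ → Matrix (Fin m₃) (Fin m₃) ℂ) :
    Matrix ((Fin m₂ × Fin m₃) ⊕ (Fin m₂ × Fin m₃)) ((Fin m₁ × Fin m₃) ⊕ (Fin m₁ × Fin m₃)) ℂ :=
  Complex.I • (Pihat1 m₁ m₂ m₃ t * Gamma2 m₁ m₂ m₃ t -
    Matrix.fromBlocks (Lp m₂ m₃ * (Lp m₁ m₃)ᴴ) 0 (K12 m₁ m₂ m₃ t) 0)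

/-- `G₂₁ = i (Π̂₂ Γ₁ - [[ℒ₁ℒ₂^*, 0], [K₁₁, 0]])`. -/
def G21 (m₁ m₂ m₃ : ℕ) (t : ℤ → ℤ → Matrix (Fin m₃) (Fin m₃) ℂ) :
    Matrix ((Fin m₁ × Fin m₃) ⊕ (Fin m₁ × Fin m₃)) ((Fin m₂ × Fin m₃) ⊕ (Fin m₂ × Fin m₃)) ℂ :=
  Complex.I • (Pihat2 m₁ m₂ m₃ t * Gamma1 m₁ m₂ m₃ t -
    Matrix.fromBlocks (Lp m₁ m₃ * (Lp m₂ m₃)ᴴ) 0 (K11 m₁ m₂ m₃ t) 0)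

/-- `G(λ) = [[G₁₁(λ₂), G₁₂], [G₂₁, G₂₂(λ₁)]]`. -/
def Gmat (m₁ m₂ m₃ : ℕ) (t : ℤ → ℤ → Matrix (Fin m₃) (Fin m₃) ℂ) (l₁ l₂ : ℂ) :
    Matrix ((((Fin m₂ × Fin m₃) ⊕ (Fin m₂ × Fin m₃))) ⊕ (((Fin m₁ × Fin m₃) ⊕ (Fin m₁ × Fin m₃))))
      ((((Fin m₂ × Fin m₃) ⊕ (Fin m₂ × Fin m₃))) ⊕ (((Fin m₁ × Fin m₃) ⊕ (Fin m₁ × Fin m₃)))) ℂ :=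
  Matrix.fromBlocks (diagKron m₂ m₃ l₂) (G12 m₁ m₂ m₃ t) (G21 m₁ m₂ m₃ t) (diagKron m₁ m₃ l₁)

/-- `E₁₂ = -i (Π̂₁ Γ₂ - [[0, 0], [K₁₂, ℒ₂ℒ₁^*]])`. -/
def E12m (m₁ m₂ m₃ : ℕ) (t : ℤ → ℤ → Matrix (Fin m₃) (Fin m₃) ℂ) :
    Matrix ((Fin m₂ × Fin m₃) ⊕ (Fin m₂ × Fin m₃)) ((Fin m₁ × Fin m₃) ⊕ (Fin m₁ × Fin m₃)) ℂ :=
  (-Complex.I) • (Pihat1 m₁ m₂ m₃ t * Gamma2 m₁ m₂ m₃ t -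
    Matrix.fromBlocks 0 0 (K12 m₁ m₂ m₃ t) (Lp m₂ m₃ * (Lp m₁ m₃)ᴴ))

/-- `E₂₁ = -i (Π̂₂ Γ₁ - [[0, 0], [K₁₁, ℒ₁ℒ₂^*]])`. -/
def E21m (m₁ m₂ m₃ : ℕ) (t : ℤ → ℤ → Matrix (Fin m₃) (Fin m₃) ℂ) :
    Matrix ((Fin m₁ × Fin m₃) ⊕ (Fin m₁ × Fin m₃)) ((Fin m₂ × Fin m₃) ⊕ (Fin m₂ × Fin m₃)) ℂ :=
  (-Complex.I) • (Pihat2 m₁ m₂ m₃ t * Gamma1 m₁ m₂ m₃ t -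
    Matrix.fromBlocks 0 0 (K11 m₁ m₂ m₃ t) (Lp m₁ m₃ * (Lp m₂ m₃)ᴴ))

/-- `E(μ) = [[E₁₁(μ₂), E₁₂], [E₂₁, E₂₂(μ₁)]]`. -/
def Emat (m₁ m₂ m₃ : ℕ) (t : ℤ → ℤ → Matrix (Fin m₃) (Fin m₃) ℂ) (mu₁ mu₂ : ℂ) :
    Matrix ((((Fin m₂ × Fin m₃) ⊕ (Fin m₂ × Fin m₃))) ⊕ (((Fin m₁ × Fin m₃) ⊕ (Fin m₁ × Fin m₃))))
      ((((Fin m₂ × Fin m₃) ⊕ (Fin m₂ × Fin m₃))) ⊕ (((Fin m₁ × Fin m₃) ⊕ (Fin m₁ × Fin m₃)))) ℂ :=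
  Matrix.fromBlocks (diagKronH m₂ m₃ mu₂) (E12m m₁ m₂ m₃ t) (E21m m₁ m₂ m₃ t) (diagKronH m₁ m₃ mu₁)

/-- `θ(λ) = i (I_{m₃} + K R (A₁-λ₁I)⁻¹ (A₂-λ₂I)⁻¹ ℒ)`. -/
def theta (m₁ m₂ m₃ : ℕ) (t : ℤ → ℤ → Matrix (Fin m₃) (Fin m₃) ℂ) (l₁ l₂ : ℂ) :
    Matrix (Fin m₃) (Fin m₃) ℂ :=
  Complex.I • (1 + Kmat m₁ m₂ m₃ t * (Tmat m₁ m₂ m₃ t)⁻¹ *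
    (A1 m₁ m₂ m₃ - l₁ • 1)⁻¹ * (A2 m₁ m₂ m₃ - l₂ • 1)⁻¹ * Lmat m₁ m₂ m₃)

/-- `ϑ(μ) = -i (I_{m₃} + ℒ^* (A₁^*-μ₁I)⁻¹ (A₂^*-μ₂I)⁻¹ R N)`. -/
def vartheta (m₁ m₂ m₃ : ℕ) (t : ℤ → ℤ → Matrix (Fin m₃) (Fin m₃) ℂ) (mu₁ mu₂ : ℂ) :
    Matrix (Fin m₃) (Fin m₃) ℂ :=
  (-Complex.I) • (1 + (Lmat m₁ m₂ m₃)ᴴ * ((A1 m₁ m₂ m₃)ᴴ - mu₁ • 1)⁻¹ *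
    ((A2 m₁ m₂ m₃)ᴴ - mu₂ • 1)⁻¹ * (Tmat m₁ m₂ m₃ t)⁻¹ * Nmat m₁ m₂ m₃ t)

/-- The exchange (anti-diagonal) matrix `U_n = {δ_{n-i-k+1}}`. -/
def Up (n : ℕ) : Matrix (Fin n) (Fin n) ℂ :=
  Matrix.of fun i k => if (i : ℕ) + (k : ℕ) + 1 = n then 1 else 0

/-- `U = U₁ ⊗ U₂ ⊗ U₃`. -/
def Umat (m₁ m₂ m₃ : ℕ) : Matrix (Idx m₁ m₂ m₃) (Idx m₁ m₂ m₃) ℂ :=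
  (Up m₁ ⊗ₖ Up m₂) ⊗ₖ Up m₃

/-- `Ũ_k = [[0, -(U_k ⊗ U₃)], [U_k ⊗ U₃, 0]]`. -/
def Utilde (n m₃ : ℕ) :
    Matrix ((Fin n × Fin m₃) ⊕ (Fin n × Fin m₃)) ((Fin n × Fin m₃) ⊕ (Fin n × Fin m₃)) ℂ :=
  Matrix.fromBlocks 0 (-(Up n ⊗ₖ Up m₃)) (Up n ⊗ₖ Up m₃) 0

/-- The DSTU property: `U₃ t_j^{(r)} U₃ = (t_j^{(r)})ᵀ` for all blocks. -/
def DSTU (m₃ : ℕ) (t : ℤ → ℤ → Matrix (Fin m₃) (Fin m₃) ℂ) : Prop :=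
  ∀ r j : ℤ, Up m₃ * t r j * Up m₃ = (t r j)ᵀ

/-- `q(μ) = ((μ₁-i/2)/(μ₁+i/2))^{m₁} ((μ₂-i/2)/(μ₂+i/2))^{m₂}`. -/
def qfun (m₁ m₂ : ℕ) (mu₁ mu₂ : ℂ) : ℂ :=
  ((mu₁ - Complex.I / 2) / (mu₁ + Complex.I / 2)) ^ m₁ *
    ((mu₂ - Complex.I / 2) / (mu₂ + Complex.I / 2)) ^ m₂

theorem sum_aEnt (n : ℕ) (j : Fin n) (g : ℕ → ℂ) :
    ∑ l : Fin n, aEnt (((j : ℕ) : ℤ) - ((l : ℕ) : ℤ)) * g l =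
      Complex.I * (2⁻¹ * g j + ∑ l ∈ Finset.range (j : ℕ), g l) := by
  rw [Fin.sum_univ_eq_sum_range (fun l => aEnt (((j : ℕ) : ℤ) - (l : ℤ)) * g l) n]
  have hj : (j : ℕ) + 1 ≤ n := j.2
  rw [← Finset.sum_subset (Finset.range_mono hj)]
  · rw [Finset.sum_range_succ, mul_add, Finset.mul_sum, add_comm]
    congr 1
    · simp [aEnt]; ring
    · apply Finset.sum_congr rfl
      intro l hl
      have := Finset.mem_range.1 hl
      have h1 : ¬ (((j : ℕ) : ℤ) - (l : ℤ) < 0) := by omega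
      have h2 : ¬ (((j : ℕ) : ℤ) - (l : ℤ) = 0) := by omega
      simp only [aEnt, h1, h2, if_false]
  · intro x _ hx
    have h1 : (((j : ℕ) : ℤ) - (x : ℤ) < 0) := by
      simp only [Finset.mem_range] at hx; omega
    simp only [aEnt, h1, if_true, zero_mul]

theorem toep_nat (f : ℤ → ℂ) (j k : ℕ) :
    f ((j : ℤ) - k) + ∑ l ∈ Finset.range j, f ((l : ℤ) - k) + ∑ l ∈ Finset.range k, f ((j : ℤ) - l)
      = f 0 + ∑ s ∈ Finset.range j, f ((s : ℤ) + 1) + ∑ s ∈ Finset.range k, f (-((s : ℤ) + 1)) := by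
  induction j with
  | zero =>
    have h1 := Finset.sum_range_succ (fun l : ℕ => f (-(l : ℤ))) k
    have h2 := Finset.sum_range_succ' (fun l : ℕ => f (-(l : ℤ))) k
    push_cast at h1 h2
    simp only [Finset.range_zero, Finset.sum_empty, Nat.cast_zero, zero_sub, add_zero, neg_zero] at *
    rw [h1] at h2
    linear_combination h2
  | succ j ih =>
    have h1 := Finset.sum_range_succ (fun l : ℕ => f ((j : ℤ) + 1 - l)) k
    have h2 := Finset.sum_range_succ' (fun l : ℕ => f ((j : ℤ) + 1 - l)) k
    rw [h1] at h2
    rw [Finset.sum_range_succ, Finset.sum_range_succ]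
    push_cast at h2 ⊢
    have h3 : ∑ l ∈ Finset.range k, f ((j : ℤ) + 1 - ((l : ℤ) + 1))
        = ∑ l ∈ Finset.range k, f ((j : ℤ) - l) :=
      Finset.sum_congr rfl fun l _ => by congr 1; ring
    rw [h3, sub_zero] at h2
    linear_combination ih + h2

theorem toep_id (n : ℕ) (j k : Fin n) (f : ℤ → ℂ) :
    ∑ l : Fin n, calA n j l * f (((l : ℕ) : ℤ) - ((k : ℕ) : ℤ)) -
      ∑ l : Fin n, f (((j : ℕ) : ℤ) - ((l : ℕ) : ℤ)) * star (calA n k l) =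
    Complex.I * ((2⁻¹ * f 0 + ∑ s ∈ Finset.range (j : ℕ), f ((s : ℤ) + 1)) +
      (2⁻¹ * f 0 + ∑ s ∈ Finset.range (k : ℕ), f (-((s : ℤ) + 1)))) := by
  have hs : ∀ l : Fin n, star (calA n k l) = - calA n k l := by
    intro l
    simp only [calA, Matrix.of_apply, aEnt]
    split_ifs <;> simp [Complex.ext_iff] <;> norm_num
  have h1 := sum_aEnt n j (fun l => f ((l : ℤ) - ((k : ℕ) : ℤ)))
  have h2 := sum_aEnt n k (fun l => f (((j : ℕ) : ℤ) - (l : ℤ)))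
  have h3 : ∑ l : Fin n, f (((j : ℕ) : ℤ) - ((l : ℕ) : ℤ)) * star (calA n k l)
      = - ∑ l : Fin n, aEnt (((k : ℕ) : ℤ) - ((l : ℕ) : ℤ)) * f (((j : ℕ) : ℤ) - ((l : ℕ) : ℤ)) := by
    rw [← Finset.sum_neg_distrib]
    refine Finset.sum_congr rfl fun l _ => ?_
    rw [hs]; simp only [calA, Matrix.of_apply]; ring
  rw [h3, h2]
  simp only [calA, Matrix.of_apply]
  rw [h1]
  linear_combination Complex.I * toep_nat f j k

theorem disp1 (m₁ m₂ m₃ : ℕ) (t : ℤ → ℤ → Matrix (Fin m₃) (Fin m₃) ℂ) :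
    A1 m₁ m₂ m₃ * Tmat m₁ m₂ m₃ t - Tmat m₁ m₂ m₃ t * (A1 m₁ m₂ m₃)ᴴ =
      Complex.I • (Pi1 m₁ m₂ m₃ t * Pihat1 m₁ m₂ m₃ t) := by
  ext ⟨⟨j, p⟩, a⟩ ⟨⟨k, q⟩, b⟩
  have h := toep_id m₁ j k (fun r => t r (((p : ℕ) : ℤ) - ((q : ℕ) : ℤ)) a b)
  rw [Pi1, Pihat1, Matrix.fromCols_mul_fromRows]
  simp only [Matrix.sub_apply, Matrix.smul_apply, Matrix.add_apply, Matrix.mul_apply, A1, Tmat,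
    Matrix.conjTranspose_apply, Matrix.kroneckerMap_apply, Matrix.one_apply, Matrix.of_apply,
    Fintype.sum_prod_type, M11, M21, M31, M41, calT, Matrix.sum_apply, smul_eq_mul]
  simp only [mul_ite, ite_mul, mul_one, mul_zero, zero_mul, one_mul, Finset.sum_ite_eq,
    Finset.mem_univ, if_true, apply_ite (star : ℂ → ℂ), star_zero, star_one, ite_and,
    Finset.sum_ite_eq', Finset.sum_const_zero, Finset.sum_ite_irrel]
  exact h

theorem disp2 (m₁ m₂ m₃ : ℕ) (t : ℤ → ℤ → Matrix (Fin m₃) (Fin m₃) ℂ) :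
    A2 m₁ m₂ m₃ * Tmat m₁ m₂ m₃ t - Tmat m₁ m₂ m₃ t * (A2 m₁ m₂ m₃)ᴴ =
      Complex.I • (Pi2 m₁ m₂ m₃ t * Pihat2 m₁ m₂ m₃ t) := by
  ext ⟨⟨j, p⟩, a⟩ ⟨⟨k, q⟩, b⟩
  have h := toep_id m₂ p q (fun r => t (((j : ℕ) : ℤ) - ((k : ℕ) : ℤ)) r a b)
  rw [Pi2, Pihat2, Matrix.fromCols_mul_fromRows]
  simp only [Matrix.sub_apply, Matrix.smul_apply, Matrix.add_apply, Matrix.mul_apply, A2, Tmat,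
    Matrix.conjTranspose_apply, Matrix.kroneckerMap_apply, Matrix.one_apply, Matrix.of_apply,
    Fintype.sum_prod_type, M12, M22, M32, M42, M12blk, M42blk, Matrix.sum_apply, smul_eq_mul]
  simp only [mul_ite, ite_mul, mul_one, mul_zero, zero_mul, one_mul, Finset.sum_ite_eq,
    Finset.mem_univ, if_true, apply_ite (star : ℂ → ℂ), star_zero, star_one, ite_and,
    Finset.sum_ite_eq', Finset.sum_const_zero, Finset.sum_ite_irrel]
  exact h

theorem calA_unit (n : ℕ) (z : ℂ) (hz : z ≠ Complex.I / 2) : IsUnit (calA n - z • 1) := by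
  rw [Matrix.isUnit_iff_isUnit_det, Matrix.det_of_isLowerTriangular]
  · rw [isUnit_iff_ne_zero, Finset.prod_ne_zero_iff]
    intro i _
    simp [calA, aEnt, sub_ne_zero, hz.symm]
  · intro i j hij
    have h : (i : ℕ) < j := by simpa using hij
    have h1 : (((i : ℕ) : ℤ) - ((j : ℕ) : ℤ) < 0) := by omega
    have h2 : i ≠ j := by rintro rfl; omega
    simp only [Matrix.sub_apply, Matrix.smul_apply, Matrix.one_apply, calA, aEnt, Matrix.of_apply, h1, h2,
      if_true, if_false, smul_zero, sub_zero]

theorem calAH_unit (n : ℕ) (z : ℂ) (hz : z ≠ -(Complex.I / 2)) : IsUnit ((calA n)ᴴ - z • 1) := by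
  have h : (calA n)ᴴ - z • 1 = (calA n - (star z) • 1)ᴴ := by
    simp [Matrix.conjTranspose_sub, Matrix.conjTranspose_smul]
  rw [h, Matrix.isUnit_conjTranspose]
  apply calA_unit
  intro h
  apply hz
  rw [← star_star z, h]
  simp [Complex.ext_iff]
  norm_num

theorem kron_unit1 (m₁ m₂ m₃ : ℕ) (B : Matrix (Fin m₁) (Fin m₁) ℂ) (hB : IsUnit B) :
    IsUnit ((B ⊗ₖ (1 : Matrix (Fin m₂) (Fin m₂) ℂ)) ⊗ₖ (1 : Matrix (Fin m₃) (Fin m₃) ℂ)) := by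
  rw [Matrix.isUnit_iff_isUnit_det] at *
  simp only [Matrix.det_kronecker, Matrix.det_one, one_pow, mul_one]
  exact (hB.pow _).pow _

theorem kron_unit2 (m₁ m₂ m₃ : ℕ) (B : Matrix (Fin m₂) (Fin m₂) ℂ) (hB : IsUnit B) :
    IsUnit (((1 : Matrix (Fin m₁) (Fin m₁) ℂ) ⊗ₖ B) ⊗ₖ (1 : Matrix (Fin m₃) (Fin m₃) ℂ)) := by
  rw [Matrix.isUnit_iff_isUnit_det] at *
  simp only [Matrix.det_kronecker, Matrix.det_one, one_pow, mul_one, one_mul]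
  exact (hB.pow _).pow _

theorem sub_kr {a b : Type*} [DecidableEq b] (X Y : Matrix a a ℂ) :
    (X - Y) ⊗ₖ (1 : Matrix b b ℂ) = X ⊗ₖ (1 : Matrix b b ℂ) - Y ⊗ₖ (1 : Matrix b b ℂ) := by
  ext i j
  simp [sub_mul]

theorem kr_sub {a b : Type*} [DecidableEq b] (X Y : Matrix a a ℂ) :
    (1 : Matrix b b ℂ) ⊗ₖ (X - Y) = (1 : Matrix b b ℂ) ⊗ₖ X - (1 : Matrix b b ℂ) ⊗ₖ Y := by
  ext i j
  simp [mul_sub]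

theorem A1_sub (m₁ m₂ m₃ : ℕ) (z : ℂ) : A1 m₁ m₂ m₃ - z • 1 =
    ((calA m₁ - z • 1) ⊗ₖ (1 : Matrix (Fin m₂) (Fin m₂) ℂ)) ⊗ₖ (1 : Matrix (Fin m₃) (Fin m₃) ℂ) := by
  simp only [A1, sub_kr, kr_sub, Matrix.smul_kronecker, Matrix.kronecker_smul,
    Matrix.conjTranspose_kronecker, Matrix.conjTranspose_one, Matrix.one_kronecker_one]

theorem A2_sub (m₁ m₂ m₃ : ℕ) (z : ℂ) : A2 m₁ m₂ m₃ - z • 1 =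
    ((1 : Matrix (Fin m₁) (Fin m₁) ℂ) ⊗ₖ (calA m₂ - z • 1)) ⊗ₖ (1 : Matrix (Fin m₃) (Fin m₃) ℂ) := by
  simp only [A2, sub_kr, kr_sub, Matrix.smul_kronecker, Matrix.kronecker_smul,
    Matrix.conjTranspose_kronecker, Matrix.conjTranspose_one, Matrix.one_kronecker_one]

theorem A1H_sub (m₁ m₂ m₃ : ℕ) (z : ℂ) : (A1 m₁ m₂ m₃)ᴴ - z • 1 =
    (((calA m₁)ᴴ - z • 1) ⊗ₖ (1 : Matrix (Fin m₂) (Fin m₂) ℂ)) ⊗ₖ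
      (1 : Matrix (Fin m₃) (Fin m₃) ℂ) := by
  simp only [A1, sub_kr, kr_sub, Matrix.smul_kronecker, Matrix.kronecker_smul,
    Matrix.conjTranspose_kronecker, Matrix.conjTranspose_one, Matrix.one_kronecker_one]

theorem A2H_sub (m₁ m₂ m₃ : ℕ) (z : ℂ) : (A2 m₁ m₂ m₃)ᴴ - z • 1 =
    ((1 : Matrix (Fin m₁) (Fin m₁) ℂ) ⊗ₖ ((calA m₂)ᴴ - z • 1)) ⊗ₖ
      (1 : Matrix (Fin m₃) (Fin m₃) ℂ) := by
  simp only [A2, sub_kr, kr_sub, Matrix.smul_kronecker, Matrix.kronecker_smul,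
    Matrix.conjTranspose_kronecker, Matrix.conjTranspose_one, Matrix.one_kronecker_one]

theorem commInv (m₁ m₂ m₃ : ℕ) (y z : ℂ) :
    (A1 m₁ m₂ m₃ - y • 1)⁻¹ * (A2 m₁ m₂ m₃ - z • 1)⁻¹ =
      (A2 m₁ m₂ m₃ - z • 1)⁻¹ * (A1 m₁ m₂ m₃ - y • 1)⁻¹ := by
  rw [← Matrix.mul_inv_rev, ← Matrix.mul_inv_rev, A1_sub, A2_sub]
  simp only [← Matrix.mul_kronecker_mul, Matrix.one_mul, Matrix.mul_one]

theorem L1 (m₁ m₂ m₃ : ℕ) (z : ℂ) (hz : z ≠ Complex.I / 2) :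
    M31 m₁ m₂ m₃ * colKronId m₃ ((calA m₂ - z • 1)⁻¹ *ᵥ (fun _ : Fin m₂ => (1 : ℂ))) =
      (A2 m₁ m₂ m₃ - z • 1)⁻¹ * Lmat m₁ m₂ m₃ := by
  have hu := calA_unit m₂ z hz
  have hU : IsUnit (A2 m₁ m₂ m₃ - z • 1) := by rw [A2_sub]; exact kron_unit2 _ _ _ _ hu
  rw [Matrix.isUnit_iff_isUnit_det] at hu hU
  set v := (calA m₂ - z • 1)⁻¹ *ᵥ (fun _ : Fin m₂ => (1 : ℂ)) with hv
  have hv2 : (calA m₂ - z • 1) *ᵥ v = fun _ => 1 := by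
    rw [hv, Matrix.mulVec_mulVec, Matrix.mul_nonsing_inv _ hu, Matrix.one_mulVec]
  have key : (A2 m₁ m₂ m₃ - z • 1) * (M31 m₁ m₂ m₃ * colKronId m₃ v) = Lmat m₁ m₂ m₃ := by
    rw [A2_sub]
    generalize calA m₂ - z • 1 = B at hv2
    ext ⟨⟨j, p⟩, a⟩ b
    have h := congrFun hv2 p
    simp only [Matrix.mulVec, dotProduct] at h
    simp only [Matrix.mul_apply, Matrix.conjTranspose_apply, Matrix.kroneckerMap_apply,
      Matrix.one_apply, Matrix.of_apply, Fintype.sum_prod_type, M31, M21, colKronId, Lmat]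
    simp only [mul_ite, ite_mul, mul_one, mul_zero, zero_mul, one_mul, Finset.sum_ite_eq,
      Finset.mem_univ, if_true, apply_ite (star : ℂ → ℂ), star_zero, star_one, ite_and,
      Finset.sum_ite_eq', Finset.sum_const_zero]
    split_ifs <;> simp [h]
  rw [← key, Matrix.nonsing_inv_mul_cancel_left _ _ hU]

theorem L2 (m₁ m₂ m₃ : ℕ) (z : ℂ) (hz : z ≠ Complex.I / 2) :
    M32 m₁ m₂ m₃ * colKronId m₃ ((calA m₁ - z • 1)⁻¹ *ᵥ (fun _ : Fin m₁ => (1 : ℂ))) =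
      (A1 m₁ m₂ m₃ - z • 1)⁻¹ * Lmat m₁ m₂ m₃ := by
  have hu := calA_unit m₁ z hz
  have hU : IsUnit (A1 m₁ m₂ m₃ - z • 1) := by rw [A1_sub]; exact kron_unit1 _ _ _ _ hu
  rw [Matrix.isUnit_iff_isUnit_det] at hu hU
  set v := (calA m₁ - z • 1)⁻¹ *ᵥ (fun _ : Fin m₁ => (1 : ℂ)) with hv
  have hv2 : (calA m₁ - z • 1) *ᵥ v = fun _ => 1 := by
    rw [hv, Matrix.mulVec_mulVec, Matrix.mul_nonsing_inv _ hu, Matrix.one_mulVec]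
  have key : (A1 m₁ m₂ m₃ - z • 1) * (M32 m₁ m₂ m₃ * colKronId m₃ v) = Lmat m₁ m₂ m₃ := by
    rw [A1_sub]
    generalize calA m₁ - z • 1 = B at hv2
    ext ⟨⟨j, p⟩, a⟩ b
    have h := congrFun hv2 j
    simp only [Matrix.mulVec, dotProduct] at h
    simp only [Matrix.mul_apply, Matrix.conjTranspose_apply, Matrix.kroneckerMap_apply,
      Matrix.one_apply, Matrix.of_apply, Fintype.sum_prod_type, M32, M22, colKronId, Lmat]
    simp only [mul_ite, ite_mul, mul_one, mul_zero, zero_mul, one_mul, Finset.sum_ite_eq,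
      Finset.mem_univ, if_true, apply_ite (star : ℂ → ℂ), star_zero, star_one, ite_and,
      Finset.sum_ite_eq', Finset.sum_const_zero]
    split_ifs <;> simp [h]
  rw [← key, Matrix.nonsing_inv_mul_cancel_left _ _ hU]

theorem core {n q l : Type*} [Fintype n] [DecidableEq n] [Fintype q] [Fintype l]
    (T A B : Matrix n n ℂ) (P : Matrix n q ℂ) (Ph : Matrix q n ℂ) (W : Matrix n l ℂ)
    (c : Matrix q l ℂ) (z : ℂ) (hT : IsUnit T) (hB : IsUnit (B - z • 1))
    (hD : A * T - T * B = Complex.I • (P * Ph)) (hc : P * c = (A - z • 1) * W) :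
    (B - z • 1)⁻¹ * (T⁻¹ * P) * (Ph * T⁻¹ * W + Complex.I • c) = Complex.I • (T⁻¹ * W) := by
  rw [Matrix.isUnit_iff_isUnit_det] at hT hB
  have h1 : T⁻¹ * A - B * T⁻¹ = Complex.I • (T⁻¹ * P * (Ph * T⁻¹)) := by
    have := congrArg (fun X => T⁻¹ * X * T⁻¹) hD
    simp only [Matrix.mul_sub, Matrix.sub_mul, Matrix.mul_smul, Matrix.smul_mul] at this
    rw [Matrix.mul_assoc T⁻¹ (A * T), Matrix.mul_assoc A, Matrix.mul_nonsing_inv _ hT,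
      Matrix.mul_one, Matrix.nonsing_inv_mul_cancel_left _ _ hT] at this
    rw [this]
    simp only [Matrix.mul_assoc]
  have h2 : T⁻¹ * P * (Ph * T⁻¹) = (-Complex.I) • (T⁻¹ * A - B * T⁻¹) := by
    rw [h1, smul_smul]; simp
  rw [Matrix.mul_assoc]
  have h3 : (T⁻¹ * P) * (Ph * T⁻¹ * W + Complex.I • c)
      = (B - z • 1) * (Complex.I • (T⁻¹ * W)) := by
    rw [Matrix.mul_add, ← Matrix.mul_assoc (T⁻¹ * P), h2, Matrix.mul_smul, Matrix.mul_assoc T⁻¹ P c,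
      hc]
    simp only [Matrix.sub_mul, Matrix.mul_sub, Matrix.smul_mul, Matrix.mul_smul, Matrix.one_mul,
      Matrix.mul_assoc]
    module
  rw [h3, Matrix.nonsing_inv_mul_cancel_left _ _ hB]

/-- `(A_p^* - λ_p I)⁻¹ Γ_p û_p(λ) = i R (A₁-λ₁I)⁻¹ (A₂-λ₂I)⁻¹ ℒ` for `p = 1, 2`. -/
theorem statement8 (m₁ m₂ m₃ : ℕ) (hm₁ : 2 ≤ m₁) (hm₂ : 2 ≤ m₂) (hm₃ : 2 ≤ m₃)
    (t : ℤ → ℤ → Matrix (Fin m₃) (Fin m₃) ℂ) (hT : IsUnit (Tmat m₁ m₂ m₃ t))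
    (l₁ l₂ : ℂ)
    (hl₁ : l₁ ≠ Complex.I / 2) (hl₁' : l₁ ≠ -(Complex.I / 2))
    (hl₂ : l₂ ≠ Complex.I / 2) (hl₂' : l₂ ≠ -(Complex.I / 2)) :
    ((A1 m₁ m₂ m₃)ᴴ - l₁ • 1)⁻¹ * Gamma1 m₁ m₂ m₃ t * uhat1 m₁ m₂ m₃ t l₁ l₂ =
      Complex.I • ((Tmat m₁ m₂ m₃ t)⁻¹ * (A1 m₁ m₂ m₃ - l₁ • 1)⁻¹ *
        (A2 m₁ m₂ m₃ - l₂ • 1)⁻¹ * Lmat m₁ m₂ m₃) ∧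
    ((A2 m₁ m₂ m₃)ᴴ - l₂ • 1)⁻¹ * Gamma2 m₁ m₂ m₃ t * uhat2 m₁ m₂ m₃ t l₁ l₂ =
      Complex.I • ((Tmat m₁ m₂ m₃ t)⁻¹ * (A1 m₁ m₂ m₃ - l₁ • 1)⁻¹ *
        (A2 m₁ m₂ m₃ - l₂ • 1)⁻¹ * Lmat m₁ m₂ m₃) := by
  constructor
  · have h := core (Tmat m₁ m₂ m₃ t) (A1 m₁ m₂ m₃) (A1 m₁ m₂ m₃)ᴴ (Pi1 m₁ m₂ m₃ t)
      (Pihat1 m₁ m₂ m₃ t)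
      ((A1 m₁ m₂ m₃ - l₁ • 1)⁻¹ * ((A2 m₁ m₂ m₃ - l₂ • 1)⁻¹ * Lmat m₁ m₂ m₃))
      (Matrix.fromRows 0
        (colKronId m₃ (Matrix.mulVec ((calA m₂ - l₂ • 1)⁻¹) (fun _ : Fin m₂ => (1 : ℂ))))) l₁ hT
      (by rw [A1H_sub]; exact kron_unit1 _ _ _ _ (calAH_unit _ _ hl₁'))
      (disp1 _ _ _ _) (by
        have hU : IsUnit (A1 m₁ m₂ m₃ - l₁ • 1) := by
          rw [A1_sub]; exact kron_unit1 _ _ _ _ (calA_unit _ _ hl₁)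
        rw [Matrix.isUnit_iff_isUnit_det] at hU
        rw [Matrix.mul_nonsing_inv_cancel_left _ _ hU, Pi1, Matrix.fromCols_mul_fromRows,
          Matrix.mul_zero, zero_add, L1 _ _ _ _ hl₂])
    simp only [uhat1, vhat1, Gamma1, Gammahat1, Matrix.mul_assoc] at h ⊢
    exact h
  · have h := core (Tmat m₁ m₂ m₃ t) (A2 m₁ m₂ m₃) (A2 m₁ m₂ m₃)ᴴ (Pi2 m₁ m₂ m₃ t)
      (Pihat2 m₁ m₂ m₃ t)
      ((A1 m₁ m₂ m₃ - l₁ • 1)⁻¹ * ((A2 m₁ m₂ m₃ - l₂ • 1)⁻¹ * Lmat m₁ m₂ m₃))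
      (Matrix.fromRows 0
        (colKronId m₃ (Matrix.mulVec ((calA m₁ - l₁ • 1)⁻¹) (fun _ : Fin m₁ => (1 : ℂ))))) l₂ hT
      (by rw [A2H_sub]; exact kron_unit2 _ _ _ _ (calAH_unit _ _ hl₂'))
      (disp2 _ _ _ _) (by
        have hU : IsUnit (A2 m₁ m₂ m₃ - l₂ • 1) := by
          rw [A2_sub]; exact kron_unit2 _ _ _ _ (calA_unit _ _ hl₂)
        rw [Matrix.isUnit_iff_isUnit_det] at hU
        rw [← Matrix.mul_assoc (A1 m₁ m₂ m₃ - l₁ • 1)⁻¹, commInv, Matrix.mul_assoc,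
          Matrix.mul_nonsing_inv_cancel_left _ _ hU, Pi2, Matrix.fromCols_mul_fromRows,
          Matrix.mul_zero, zero_add, L2 _ _ _ _ hl₁])
    simp only [uhat2, vhat2, Gamma2, Gammahat2, Matrix.mul_assoc] at h ⊢
    exact h

end TBT
end
end

section
/- For every block TBT-matrix T and for {k,p} = {1,2} with k ≠ p, the identity (𝒜_k⊗I_{m₃})M_{4p} − M_{4p}A_k^* = i(K_{1k}M_{2k} + ℒ_k K) holds. -/
open Matrix Kronecker BigOperators

noncomputable section

namespace TBT

theorem aux_A (n : ℕ) (p : Fin n) (g : ℕ → ℂ) :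
    ∑ j : Fin n, aEnt (((p : ℕ) : ℤ) - ((j : ℕ) : ℤ)) * g j =
      Complex.I * (g p / 2 + ∑ j ∈ Finset.range (p : ℕ), g j) := by
  rw [Fin.sum_univ_eq_sum_range (fun j : ℕ => aEnt (((p : ℕ) : ℤ) - (j : ℤ)) * g j) n]
  have hp : (p : ℕ) + 1 ≤ n := p.2
  rw [← Finset.sum_subset (Finset.range_mono hp), Finset.sum_range_succ, mul_add, Finset.mul_sum,
    add_comm]
  · congr 1
    · simp [aEnt]; ring
    · apply Finset.sum_congr rfl
      intro j hj
      have := Finset.mem_range.1 hj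
      rw [aEnt, if_neg (by omega), if_neg (by omega)]
  · intro j _ hj
    have : ¬ j < (p : ℕ) + 1 := fun h => hj (Finset.mem_range.2 h)
    rw [aEnt, if_pos (by omega), zero_mul]

theorem aux_S (f : ℤ → ℂ) (p q : ℕ) :
    f ((p : ℤ) - q) + ∑ j ∈ Finset.range p, f ((j : ℤ) - q) +
      ∑ j ∈ Finset.range q, f ((p : ℤ) - j) =
    f 0 + ∑ s ∈ Finset.range p, f ((s : ℤ) + 1) + ∑ s ∈ Finset.range q, f (-((s : ℤ) + 1)) := by
  induction q with
  | zero =>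
    have h1 := Finset.sum_range_succ (fun j : ℕ => f (j : ℤ)) p
    have h2 := Finset.sum_range_succ' (fun j : ℕ => f (j : ℤ)) p
    push_cast at h1 h2
    simp only [Nat.cast_zero, sub_zero, Finset.range_zero, Finset.sum_empty, add_zero]
    rw [add_comm, ← h1, h2, add_comm]
  | succ q ih =>
    have h1 := Finset.sum_range_succ (fun j : ℕ => f ((j : ℤ) - ((q : ℤ) + 1))) p
    have h2 := Finset.sum_range_succ' (fun j : ℕ => f ((j : ℤ) - ((q : ℤ) + 1))) p
    push_cast at h1 h2
    have h3 : ∀ j : ℕ, ((j : ℤ) + 1 - ((q : ℤ) + 1)) = (j : ℤ) - q := fun j => by ring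
    have h4 : (0 : ℤ) - ((q : ℤ) + 1) = -((q : ℤ) + 1) := by ring
    simp only [h3, h4] at h2
    rw [Finset.sum_range_succ, Finset.sum_range_succ _ q]
    push_cast
    linear_combination ih - h1 + h2

theorem aux_core (n : ℕ) (f : ℤ → ℂ) (p q : Fin n) :
    ∑ j : Fin n, aEnt (((p : ℕ) : ℤ) - ((j : ℕ) : ℤ)) * f (((j : ℕ) : ℤ) - ((q : ℕ) : ℤ)) -
      ∑ j : Fin n, f (((p : ℕ) : ℤ) - ((j : ℕ) : ℤ)) *
        (starRingEnd ℂ) (aEnt (((q : ℕ) : ℤ) - ((j : ℕ) : ℤ))) =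
    Complex.I * ((2⁻¹ * f 0 + ∑ s ∈ Finset.range (p : ℕ), f ((s : ℤ) + 1)) +
      (2⁻¹ * f 0 + ∑ s ∈ Finset.range (q : ℕ), f (-((s : ℤ) + 1)))) := by
  have hc : ∀ r, (starRingEnd ℂ) (aEnt r) = - aEnt r := by
    intro r
    unfold aEnt
    split_ifs <;> simp [neg_div, Complex.conj_ofNat]
  have h1 := aux_A n p (fun j => f ((j : ℤ) - ((q : ℕ) : ℤ)))
  have h2 := aux_A n q (fun j => f (((p : ℕ) : ℤ) - (j : ℤ)))
  have h3 := aux_S f p q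
  simp only [hc, mul_neg, Finset.sum_neg_distrib]
  rw [h1]
  simp_rw [mul_comm (f _) (aEnt _)]
  rw [h2]
  linear_combination Complex.I * h3

/-- `(𝒜_k ⊗ I_{m₃}) M_{4p} - M_{4p} A_k^* = i (K_{1k} M_{2k} + ℒ_k K)` for
`{k, p} = {1, 2}`, `k ≠ p`. -/
theorem statement9 (m₁ m₂ m₃ : ℕ) (hm₁ : 2 ≤ m₁) (hm₂ : 2 ≤ m₂) (hm₃ : 2 ≤ m₃)
    (t : ℤ → ℤ → Matrix (Fin m₃) (Fin m₃) ℂ) :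
    (calA m₂ ⊗ₖ (1 : Matrix (Fin m₃) (Fin m₃) ℂ)) * M41 m₁ m₂ m₃ t -
        M41 m₁ m₂ m₃ t * (A2 m₁ m₂ m₃)ᴴ =
      Complex.I • (K12 m₁ m₂ m₃ t * M22 m₁ m₂ m₃ + Lp m₂ m₃ * Kmat m₁ m₂ m₃ t) ∧
    (calA m₁ ⊗ₖ (1 : Matrix (Fin m₃) (Fin m₃) ℂ)) * M42 m₁ m₂ m₃ t -
        M42 m₁ m₂ m₃ t * (A1 m₁ m₂ m₃)ᴴ =
      Complex.I • (K11 m₁ m₂ m₃ t * M21 m₁ m₂ m₃ + Lp m₁ m₃ * Kmat m₁ m₂ m₃ t) := by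
  constructor
  · ext ⟨p, a⟩ ⟨⟨k, q⟩, b⟩
    have h := aux_core m₂ (fun r => 2⁻¹ * t 0 r a b +
      ∑ s ∈ Finset.range (k : ℕ), t (-((s : ℤ) + 1)) r a b) p q
    refine Eq.trans (Eq.trans ?_ h) ?_
    · simp [Matrix.mul_apply, Fintype.sum_prod_type, A2, M41, calA, calT, Matrix.one_apply,
        Matrix.sum_apply, Finset.sum_ite_eq, apply_ite (starRingEnd ℂ), ite_and]
    · simp [Matrix.mul_apply, Fintype.sum_prod_type, K12, M22, Lp, Kmat, M12blk, M42blk,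
        Matrix.sum_apply, ite_and]
      simp only [Finset.sum_add_distrib, Finset.mul_sum, mul_add]
      rw [Finset.sum_comm, Finset.sum_comm (s := Finset.range (q : ℕ))]
      ring
  · ext ⟨p, a⟩ ⟨⟨q, k⟩, b⟩
    have h := aux_core m₁ (fun r => M42blk m₂ m₃ t r a (k, b)) p q
    refine Eq.trans (Eq.trans ?_ h) ?_
    · simp [Matrix.mul_apply, Fintype.sum_prod_type, A1, M42, calA, Matrix.one_apply,
        Finset.sum_ite_eq, apply_ite (starRingEnd ℂ), ite_and]
    · simp [Matrix.mul_apply, Fintype.sum_prod_type, K11, M21, Lp, Kmat,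
        Matrix.sum_apply, ite_and]

end TBT
end
end

section
/- For every block TBT-matrix T and for {k,p} = {1,2} with k ≠ p, the identity A_p M_{1k} − M_{1k}(𝒜_p^*⊗I_{m₃}) = i(N ℒ_p^* + M_{3p}K_{1k}) holds, where N = col[(1/2)M₁₂^{(0)}, (1/2)M₁₂^{(0)}+M₁₂^{(1)}, …, (1/2)M₁₂^{(0)}+Σ_{j=1}^{m₁−1}M₁₂^{(j)}]. -/
open Matrix Kronecker BigOperators

noncomputable section

namespace TBT

theorem key_aux (f : ℤ → ℂ) (x y : ℕ) :
    ∑ l ∈ Finset.range x, f ((l : ℤ) - y) + f ((x : ℤ) - y) + ∑ l ∈ Finset.range y, f ((x : ℤ) - l)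
      = f 0 + ∑ j ∈ Finset.range x, f ((j : ℤ) + 1) + ∑ j ∈ Finset.range y, f (-((j : ℤ) + 1)) := by
  induction y with
  | zero =>
    have h := Finset.sum_range_succ (fun l : ℕ => f (l : ℤ)) x
    rw [Finset.sum_range_succ'] at h
    push_cast at h
    simp only [Nat.cast_zero, sub_zero, Finset.range_zero, Finset.sum_empty, add_zero]
    rw [← h, add_comm]
  | succ y ih =>
    have h := Finset.sum_range_succ (fun l : ℕ => f ((l : ℤ) - (y + 1))) x
    rw [Finset.sum_range_succ'] at h
    have e : ∀ k : ℕ, (((k + 1 : ℕ) : ℤ) - ((y : ℤ) + 1)) = (k : ℤ) - y := fun k => by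
      push_cast; ring
    simp only [e] at h
    rw [Finset.sum_range_succ, Finset.sum_range_succ (fun j : ℕ => f (-((j : ℤ) + 1))) y]
    have e2 : (((0 : ℕ) : ℤ) - ((y : ℤ) + 1)) = -((y : ℤ) + 1) := by push_cast; ring
    rw [e2] at h
    push_cast
    linear_combination ih - h

theorem calA_sum (n : ℕ) (g : ℤ → ℂ) (x : Fin n) :
    ∑ l : Fin n, calA n x l * g ((l : ℕ) : ℤ) =
      Complex.I * (∑ l ∈ Finset.range (x : ℕ), g l + 2⁻¹ * g ((x : ℕ) : ℤ)) := by
  have h1 : ∀ l : ℕ, aEnt (((x : ℕ) : ℤ) - (l : ℤ)) * g l =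
      (if l < (x : ℕ) then Complex.I * g l else 0) +
      (if l = (x : ℕ) then Complex.I * (2⁻¹ * g l) else 0) := by
    intro l
    unfold aEnt
    rcases lt_trichotomy l (x : ℕ) with h | h | h
    · rw [if_neg (by omega), if_neg (by omega), if_pos h, if_neg (by omega), add_zero]
    · rw [if_neg (by omega), if_pos (by omega), if_neg (by omega), if_pos h]; ring
    · rw [if_pos (by omega), if_neg (by omega), if_neg (by omega)]; ring
  simp only [calA, Matrix.of_apply]
  rw [Fin.sum_univ_eq_sum_range (fun l : ℕ => aEnt (((x : ℕ) : ℤ) - (l : ℤ)) * g l) n]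
  simp only [h1]
  rw [Finset.sum_add_distrib, Finset.sum_ite_eq' , if_pos (Finset.mem_range.2 x.2),
    ← Finset.sum_filter]
  have : (Finset.range n).filter (fun l => l < (x : ℕ)) = Finset.range (x : ℕ) := by
    ext l; have := x.2; simp; omega
  rw [this, mul_add, Finset.mul_sum]

theorem calAH_sum (n : ℕ) (g : ℤ → ℂ) (y : Fin n) :
    ∑ l : Fin n, g ((l : ℕ) : ℤ) * star (calA n y l) =
      -Complex.I * (∑ l ∈ Finset.range (y : ℕ), g l + 2⁻¹ * g ((y : ℕ) : ℤ)) := by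
  have h : ∀ l : Fin n, star (calA n y l) = - calA n y l := by
    intro l
    simp only [calA, Matrix.of_apply, aEnt]
    split_ifs <;> simp [neg_div]
  simp only [h, mul_neg, Finset.sum_neg_distrib, neg_mul]
  rw [← calA_sum, neg_inj]
  exact Finset.sum_congr rfl fun l _ => mul_comm _ _

theorem key (n : ℕ) (f : ℤ → ℂ) (x y : Fin n) :
    ∑ l : Fin n, calA n x l * f (((l : ℕ) : ℤ) - ((y : ℕ) : ℤ)) -
      ∑ l : Fin n, f (((x : ℕ) : ℤ) - ((l : ℕ) : ℤ)) * star (calA n y l) =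
    Complex.I * ((2⁻¹ * f 0 + ∑ j ∈ Finset.range (x : ℕ), f ((j : ℤ) + 1)) +
      (2⁻¹ * f 0 + ∑ j ∈ Finset.range (y : ℕ), f (-((j : ℤ) + 1)))) := by
  rw [calA_sum n (fun z => f (z - ((y : ℕ) : ℤ))) x, calAH_sum n (fun z => f (((x : ℕ) : ℤ) - z)) y]
  linear_combination Complex.I * key_aux f x y

/-- `A_p M_{1k} - M_{1k} (𝒜_p^* ⊗ I_{m₃}) = i (N ℒ_p^* + M_{3p} K_{1k})` for
`{k, p} = {1, 2}`, `k ≠ p`. -/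
theorem statement10 (m₁ m₂ m₃ : ℕ) (hm₁ : 2 ≤ m₁) (hm₂ : 2 ≤ m₂) (hm₃ : 2 ≤ m₃)
    (t : ℤ → ℤ → Matrix (Fin m₃) (Fin m₃) ℂ) :
    A2 m₁ m₂ m₃ * M11 m₁ m₂ m₃ t -
        M11 m₁ m₂ m₃ t * ((calA m₂)ᴴ ⊗ₖ (1 : Matrix (Fin m₃) (Fin m₃) ℂ)) =
      Complex.I • (Nmat m₁ m₂ m₃ t * (Lp m₂ m₃)ᴴ + M32 m₁ m₂ m₃ * K11 m₁ m₂ m₃ t) ∧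
    A1 m₁ m₂ m₃ * M12 m₁ m₂ m₃ t -
        M12 m₁ m₂ m₃ t * ((calA m₁)ᴴ ⊗ₖ (1 : Matrix (Fin m₃) (Fin m₃) ℂ)) =
      Complex.I • (Nmat m₁ m₂ m₃ t * (Lp m₁ m₃)ᴴ + M31 m₁ m₂ m₃ * K12 m₁ m₂ m₃ t) := by
  constructor
  · ext ⟨⟨a, b⟩, c⟩ ⟨d, e⟩
    have k := key m₂ (fun s => 2⁻¹ * t 0 s c e +
      ∑ r ∈ Finset.range (a : ℕ), t ((r : ℤ) + 1) s c e) b d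
    simp [Matrix.mul_apply, Fintype.sum_prod_type, A2, M11, calT, Nmat, Lp, M32, M22, K11,
      M12blk, M42blk, Matrix.sum_apply, Matrix.one_apply, ite_and, apply_ite (starRingEnd ℂ), -neg_add_rev]
    refine k.trans ?_
    simp only [Finset.sum_add_distrib, ← Finset.mul_sum]
    rw [Finset.sum_comm (s := Finset.range (b : ℕ)), Finset.sum_comm (s := Finset.range (d : ℕ))]
    ring
  · ext ⟨⟨a, b⟩, c⟩ ⟨d, e⟩
    have k := key m₁ (fun s => 2⁻¹ * t s 0 c e +
      ∑ r ∈ Finset.range (b : ℕ), t s ((r : ℤ) + 1) c e) a d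
    simp [Matrix.mul_apply, Fintype.sum_prod_type, A1, M12, Nmat, Lp, M31, M21, K12,
      M12blk, Matrix.sum_apply, Matrix.one_apply, ite_and, apply_ite (starRingEnd ℂ), -neg_add_rev]
    exact k

end TBT
end
end
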